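/- For every K₀ ∈ S there exists a unique infinitely differentiable curve K : [0, ∞) → S with K(0) = K₀ satisfying the gradient flow equation K'(t) = −∇f(K(t)) for all t ≥ 0, where ∇f(K) = 2(RK − BᵀX(K)(A−BK))Y(K). -/

import Mathlib

open Matrix

attribute [local instance] Matrix.normedAddCommGroup Matrix.normedSpace

/-- `M` is Schur stable: spectral radius `ρ(M) < 1`. -/
def IsSchur {k : ℕ} (M : Matrix (Fin k) (Fin k) ℝ) : Prop :=
  ∀ μ ∈ spectrum ℂ (M.map (Complex.ofReal ·)), ‖μ‖ < 1

/-- `Kc : [0, ∞) → S` is an infinitely differentiable solution of the gradient flow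
`K' = −∇f(K)`, `K(0) = K₀`, where `∇f(K) = 2(RK − BᵀX(K)(A−BK))Y(K)`. -/
def IsGradFlowSol {n m : ℕ} (A : Matrix (Fin n) (Fin n) ℝ) (B : Matrix (Fin n) (Fin m) ℝ)
    (R : Matrix (Fin m) (Fin m) ℝ)
    (X Y : Matrix (Fin m) (Fin n) ℝ → Matrix (Fin n) (Fin n) ℝ)
    (K₀ : Matrix (Fin m) (Fin n) ℝ) (Kc : ℝ → Matrix (Fin m) (Fin n) ℝ) : Prop :=
  Kc 0 = K₀ ∧
  (∀ t ∈ Set.Ici (0 : ℝ), IsSchur (A - B * Kc t)) ∧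
  ContDiffOn ℝ (⊤ : ℕ∞) Kc (Set.Ici (0 : ℝ)) ∧
  ∀ t ∈ Set.Ici (0 : ℝ),
    HasDerivWithinAt Kc
      (-((2 : ℝ) • ((R * Kc t - Bᵀ * X (Kc t) * (A - B * Kc t)) * Y (Kc t))))
      (Set.Ici (0 : ℝ)) t

section GradientLikeFlow

open Set Filter Topology NNReal Manifold ContDiff

variable {E : Type*} [NormedAddCommGroup E] [NormedSpace ℝ E]

theorem exists_cutoff_smul [FiniteDimensional ℝ E] {S C : Set E} {F : E → E} (hS : IsOpen S)
    (hF : ContDiffOn ℝ ∞ F S) (hC : IsCompact C) (hCS : C ⊆ S) :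
    ∃ χ : E → ℝ, (∀ x, 0 ≤ χ x) ∧ (∀ x ∈ C, χ x = 1) ∧
      ContDiff ℝ ∞ (fun x ↦ χ x • F x) ∧ HasCompactSupport (fun x ↦ χ x • F x) := by
  obtain ⟨N, hN, hCN, hNS⟩ := exists_compact_between hC hS hCS
  obtain ⟨χ, h1, h0, hI⟩ :=
    exists_contMDiffMap_one_nhds_of_subset_interior (n := ⊤) 𝓘(ℝ, E) hC.isClosed hCN
  have hχ : ContDiff ℝ ∞ χ := χ.contMDiff.contDiff
  refine ⟨χ, fun x ↦ (hI x).1, fun x hx ↦ h1.self_of_nhdsSet x hx, ?_, ?_⟩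
  · rw [contDiff_iff_contDiffAt]
    intro x
    by_cases hx : x ∈ S
    · exact hχ.contDiffAt.smul (hF.contDiffAt (hS.mem_nhds hx))
    · have : (fun x ↦ χ x • F x) =ᶠ[𝓝 x] fun _ ↦ 0 := by
        filter_upwards [hN.isClosed.isOpen_compl.mem_nhds fun h ↦ hx (hNS h)] with y hy
        simp [h0 y hy]
      exact contDiffAt_const.congr_of_eventuallyEq this
  · refine HasCompactSupport.intro hN fun x hx ↦ ?_
    simp [h0 x hx]

theorem exists_hasDerivAt_of_lipschitzWith_of_bounded [CompleteSpace E] {G : E → E} {L M : ℝ≥0}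
    (hL : LipschitzWith L G) (hM : ∀ x, ‖G x‖ ≤ M) (x₀ : E) :
    ∃ γ : ℝ → E, γ 0 = x₀ ∧ ∀ t, HasDerivAt γ (G (γ t)) t := by
  have loc : ∀ N : ℕ, ∃ α : ℝ → E, α 0 = x₀ ∧
      ∀ t ∈ Ioo (-(N + 1 : ℝ)) (N + 1), HasDerivAt α (G (α t)) t := by
    intro N
    have h0 : (0 : ℝ) ∈ Icc (-(N + 1 : ℝ)) (N + 1) := by
      constructor <;> linarith [N.cast_nonneg (α := ℝ)]
    have hP : IsPicardLindelof (fun _ ↦ G) (⟨0, h0⟩ : Icc (-(N + 1 : ℝ)) (N + 1)) x₀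
        (M * (N + 1)) 0 M L :=
      { lipschitzOnWith := fun _ _ ↦ hL.lipschitzOnWith
        continuousOn := fun _ _ ↦ continuousOn_const
        norm_le := fun _ _ x _ ↦ hM x
        mul_max_le := by simp }
    obtain ⟨α, hα0, hα⟩ := hP.exists_eq_forall_mem_Icc_hasDerivWithinAt₀
    exact ⟨α, hα0, fun t ht ↦ (hα t (Ioo_subset_Icc_self ht)).hasDerivAt (Icc_mem_nhds ht.1 ht.2)⟩
  choose α hα0 hα using loc
  have agree : ∀ {N N' : ℕ}, N ≤ N' → EqOn (α N) (α N') (Ioo (-(N + 1 : ℝ)) (N + 1)) := by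
    intro N N' h
    have h' : (N : ℝ) ≤ N' := by exact_mod_cast h
    refine ODE_solution_unique_of_mem_Ioo (v := fun _ ↦ G) (s := fun _ ↦ univ) (t₀ := 0) (K := L)
      (fun _ _ ↦ hL.lipschitzOnWith) (by constructor <;> linarith [N.cast_nonneg (α := ℝ)])
      (fun t ht ↦ ⟨hα N t ht, trivial⟩) (fun t ht ↦ ⟨hα N' t ⟨?_, ?_⟩, trivial⟩)
      ((hα0 N).trans (hα0 N').symm) <;> linarith [ht.1, ht.2]
  refine ⟨fun t ↦ α ⌈|t|⌉₊ t, by simp [hα0], fun t ↦ ?_⟩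
  have key : ∀ s ∈ Ioo (-(⌈|t|⌉₊ + 1 : ℝ)) (⌈|t|⌉₊ + 1),
      α ⌈|s|⌉₊ s = α (⌈|t|⌉₊ + 1) s := by
    intro s hs
    have hs' : |s| ≤ (⌈|t|⌉₊ + 1 : ℕ) := by push_cast; exact (abs_lt.2 hs).le
    refine agree (Nat.ceil_le.2 hs') (abs_lt.1 ?_)
    linarith [Nat.le_ceil |s|]
  have ht : t ∈ Ioo (-(⌈|t|⌉₊ + 1 : ℝ)) (⌈|t|⌉₊ + 1) :=
    abs_lt.1 (by linarith [Nat.le_ceil |t|])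
  simp only [key t ht]
  refine (hα (⌈|t|⌉₊ + 1) t ?_).congr_of_eventuallyEq ?_
  · push_cast
    exact ⟨by linarith [ht.1], by linarith [ht.2]⟩
  · filter_upwards [Ioo_mem_nhds ht.1 ht.2] with s hs using key s hs

theorem contDiff_of_hasDerivAt_comp {G : E → E} (hG : ContDiff ℝ ∞ G) {γ : ℝ → E}
    (hγ : ∀ t, HasDerivAt γ (G (γ t)) t) : ContDiff ℝ ∞ γ := by
  have hd : deriv γ = fun t ↦ G (γ t) := funext fun t ↦ (hγ t).deriv
  rw [contDiff_infty]
  intro n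
  induction n with
  | zero => exact contDiff_zero.2 (continuous_iff_continuousAt.2 fun t ↦ (hγ t).continuousAt)
  | succ n ih =>
    push_cast
    rw [contDiff_succ_iff_deriv]
    refine ⟨fun t ↦ (hγ t).differentiableAt, by simp, ?_⟩
    rw [hd]
    exact (hG.of_le (by exact_mod_cast le_top)).comp ih

theorem forall_mem_sublevel_of_hasDerivAt {S : Set E} (hS : IsOpen S) {F : E → E} {V : E → ℝ}
    (hV : DifferentiableOn ℝ V S) (hVF : ∀ x ∈ S, fderiv ℝ V x (F x) ≤ 0) {χ : E → ℝ}
    (hχ : ∀ x, 0 ≤ χ x) {c : ℝ} (hC : IsClosed {x ∈ S | V x ≤ c}) {γ : ℝ → E}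
    (hγ : ∀ t, HasDerivAt γ (χ (γ t) • F (γ t)) t) (h0 : γ 0 ∈ {x ∈ S | V x ≤ c}) {t : ℝ}
    (ht : 0 ≤ t) : γ t ∈ {x ∈ S | V x ≤ c} := by
  have hcont : Continuous γ := continuous_iff_continuousAt.2 fun t ↦ (hγ t).continuousAt
  refine IsClosed.Icc_subset_of_forall_exists_gt (s := γ ⁻¹' {x ∈ S | V x ≤ c})
    ((hC.preimage hcont).inter isClosed_Icc) h0 ?_ ⟨ht, le_rfl⟩
  rintro r ⟨⟨hrS, hrc⟩, -⟩ y (hy : r < y)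
  obtain ⟨ε, hε, hball⟩ := Metric.isOpen_iff.1 (hS.preimage hcont) r hrS
  have hlt : r < min y (r + ε / 2) := lt_min hy (by linarith)
  have hsub : ∀ s ∈ Icc r (min y (r + ε / 2)), γ s ∈ S := by
    intro s hs
    refine hball ?_
    rw [Metric.mem_ball, Real.dist_eq, abs_lt]
    constructor <;> linarith [hs.1, hs.2, min_le_right y (r + ε / 2)]
  have hder : ∀ s ∈ Icc r (min y (r + ε / 2)),
      HasDerivAt (V ∘ γ) (fderiv ℝ V (γ s) (χ (γ s) • F (γ s))) s := fun s hs ↦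
    ((hV.differentiableAt (hS.mem_nhds (hsub s hs))).hasFDerivAt).comp_hasDerivAt s (hγ s)
  have hanti : AntitoneOn (V ∘ γ) (Icc r (min y (r + ε / 2))) := by
    refine antitoneOn_of_deriv_nonpos (convex_Icc _ _)
      (fun s hs ↦ (hder s hs).continuousAt.continuousWithinAt)
      (fun s hs ↦ (hder s (interior_subset hs)).differentiableAt.differentiableWithinAt)
      fun s hs ↦ ?_
    have hs' := interior_subset hs
    rw [(hder s hs').deriv, map_smul, smul_eq_mul]
    exact mul_nonpos_of_nonneg_of_nonpos (hχ _) (hVF _ (hsub s hs'))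
  refine ⟨min y (r + ε / 2), ⟨hsub _ ⟨hlt.le, le_rfl⟩, ?_⟩, hlt, min_le_left _ _⟩
  exact (hanti ⟨le_rfl, hlt.le⟩ ⟨hlt.le, le_rfl⟩ hlt.le).trans hrc

/-- A smooth vector field on an open set which decreases a function with compact sublevel sets
has a smooth forward flow defined for all positive times. -/
theorem exists_contDiff_flow_of_isCompact_sublevel [FiniteDimensional ℝ E] {S : Set E}
    (hS : IsOpen S) {F : E → E} (hF : ContDiffOn ℝ ∞ F S) {V : E → ℝ}
    (hV : DifferentiableOn ℝ V S) (hVF : ∀ x ∈ S, fderiv ℝ V x (F x) ≤ 0) {x₀ : E} (hx₀ : x₀ ∈ S)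
    (hC : IsCompact {x ∈ S | V x ≤ V x₀}) :
    ∃ γ : ℝ → E, γ 0 = x₀ ∧ ContDiff ℝ ∞ γ ∧
      ∀ t, 0 ≤ t → γ t ∈ S ∧ HasDerivAt γ (F (γ t)) t := by
  have := FiniteDimensional.complete ℝ E
  obtain ⟨χ, hχ, h1, hG, hGc⟩ := exists_cutoff_smul hS hF hC (fun x hx ↦ hx.1)
  obtain ⟨L, hL⟩ := hG.lipschitzWith_of_hasCompactSupport hGc (by simp)
  obtain ⟨M, hM⟩ := hGc.exists_bound_of_continuous hG.continuous
  obtain ⟨γ, hγ0, hγ⟩ := exists_hasDerivAt_of_lipschitzWith_of_bounded (M := M.toNNReal) hL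
    (fun x ↦ (hM x).trans (Real.le_coe_toNNReal M)) x₀
  refine ⟨γ, hγ0, contDiff_of_hasDerivAt_comp hG hγ, fun t ht ↦ ?_⟩
  have hmem := forall_mem_sublevel_of_hasDerivAt hS hV hVF hχ hC.isClosed hγ
    (by rw [hγ0]; exact ⟨hx₀, le_rfl⟩) ht
  refine ⟨hmem.1, ?_⟩
  simpa [h1 _ hmem] using hγ t

theorem eqOn_Ici_of_hasDerivWithinAt [FiniteDimensional ℝ E] {S : Set E}
    (hS : IsOpen S) {F : E → E} (hF : ContDiffOn ℝ ∞ F S) {γ₁ γ₂ : ℝ → E}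
    (hS₁ : ∀ t ∈ Ici (0 : ℝ), γ₁ t ∈ S) (hS₂ : ∀ t ∈ Ici (0 : ℝ), γ₂ t ∈ S)
    (h₁ : ∀ t ∈ Ici (0 : ℝ), HasDerivWithinAt γ₁ (F (γ₁ t)) (Ici 0) t)
    (h₂ : ∀ t ∈ Ici (0 : ℝ), HasDerivWithinAt γ₂ (F (γ₂ t)) (Ici 0) t)
    (h0 : γ₁ 0 = γ₂ 0) : EqOn γ₁ γ₂ (Ici 0) := by
  intro T hT
  have c₁ : ContinuousOn γ₁ (Icc 0 T) := fun t ht ↦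
    (h₁ t ht.1).continuousWithinAt.mono Icc_subset_Ici_self
  have c₂ : ContinuousOn γ₂ (Icc 0 T) := fun t ht ↦
    (h₂ t ht.1).continuousWithinAt.mono Icc_subset_Ici_self
  obtain ⟨χ, -, h1, hG, hGc⟩ := exists_cutoff_smul hS hF
    ((isCompact_Icc.image_of_continuousOn c₁).union (isCompact_Icc.image_of_continuousOn c₂))
    (by rintro _ (⟨t, ht, rfl⟩ | ⟨t, ht, rfl⟩); exacts [hS₁ t ht.1, hS₂ t ht.1])
  obtain ⟨L, hL⟩ := hG.lipschitzWith_of_hasCompactSupport hGc (by simp)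
  refine ODE_solution_unique (v := fun _ x ↦ χ x • F x) (fun _ ↦ hL) c₁ (fun t ht ↦ ?_) c₂
    (fun t ht ↦ ?_) h0 ⟨hT, le_rfl⟩
  · rw [h1 _ (Or.inl ⟨t, Ico_subset_Icc_self ht, rfl⟩), one_smul]
    exact (h₁ t ht.1).mono (Ici_subset_Ici.2 ht.1)
  · rw [h1 _ (Or.inr ⟨t, Ico_subset_Icc_self ht, rfl⟩), one_smul]
    exact (h₂ t ht.1).mono (Ici_subset_Ici.2 ht.1)

end GradientLikeFlow

section SpectralRadius

open Filter Topology

theorem tendsto_pow_zero_of_forall_spectrum_norm_lt_one {𝒜 : Type*} [NormedRing 𝒜]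
    [NormedAlgebra ℂ 𝒜] [CompleteSpace 𝒜] {a : 𝒜} (ha : ∀ μ ∈ spectrum ℂ a, ‖μ‖ < 1) :
    Tendsto (fun j ↦ a ^ j) atTop (𝓝 0) := by
  cases subsingleton_or_nontrivial 𝒜
  · exact tendsto_const_nhds.congr fun _ ↦ Subsingleton.elim _ _
  have hρ : spectralRadius ℂ a < (1 : NNReal) :=
    spectrum.spectralRadius_lt_of_forall_lt a fun μ hμ ↦ by exact_mod_cast ha μ hμ
  obtain ⟨r, hρr, hr1⟩ := ENNReal.lt_iff_exists_nnreal_btwn.1 hρ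
  have hr1' : r < 1 := by exact_mod_cast hr1
  refine squeeze_zero_norm' ?_ (tendsto_pow_atTop_nhds_zero_of_lt_one r.2 hr1')
  filter_upwards [(spectrum.pow_nnnorm_pow_one_div_tendsto_nhds_spectralRadius a).eventually_lt_const
    hρr, eventually_gt_atTop 0] with j hj hj0
  have hj0' : (j : ℝ) ≠ 0 := by exact_mod_cast hj0.ne'
  have := ENNReal.rpow_le_rpow hj.le j.cast_nonneg
  rw [← ENNReal.rpow_mul, one_div_mul_cancel hj0', ENNReal.rpow_one, ENNReal.rpow_natCast] at this
  exact_mod_cast this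

theorem isOpen_setOf_forall_spectrum_norm_lt_one {𝒜 : Type*} [NormedRing 𝒜]
    [NormedAlgebra ℂ 𝒜] [CompleteSpace 𝒜] :
    IsOpen {a : 𝒜 | ∀ μ ∈ spectrum ℂ a, ‖μ‖ < 1} := by
  have := (upperHemicontinuous_iff_isOpen_preimage_Iic.1 (upperHemicontinuous_spectrum ℂ 𝒜))
    (Metric.ball 0 1) Metric.isOpen_ball
  simpa [Set.preimage, Set.subset_def] using this

end SpectralRadius

section Schur

open Filter Topology

variable {n : ℕ}

attribute [local instance] Matrix.linftyOpNormedRing Matrix.linftyOpNormedAlgebra in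
theorem Matrix.tendsto_pow_zero_of_forall_spectrum_norm_lt_one {M : Matrix (Fin n) (Fin n) ℂ}
    (hM : ∀ μ ∈ spectrum ℂ M, ‖μ‖ < 1) : Tendsto (fun j ↦ M ^ j) atTop (𝓝 0) :=
  @_root_.tendsto_pow_zero_of_forall_spectrum_norm_lt_one _ _ _ (FiniteDimensional.complete ℂ _) _ hM

attribute [local instance] Matrix.linftyOpNormedRing Matrix.linftyOpNormedAlgebra in
theorem Matrix.isOpen_setOf_forall_spectrum_norm_lt_one :
    IsOpen {M : Matrix (Fin n) (Fin n) ℂ | ∀ μ ∈ spectrum ℂ M, ‖μ‖ < 1} :=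
  @_root_.isOpen_setOf_forall_spectrum_norm_lt_one _ _ _ (FiniteDimensional.complete ℂ _)

theorem isOpen_setOf_isSchur : IsOpen {M : Matrix (Fin n) (Fin n) ℝ | IsSchur M} :=
  Matrix.isOpen_setOf_forall_spectrum_norm_lt_one.preimage
    (continuous_id.matrix_map Complex.continuous_ofReal)

theorem IsSchur.tendsto_pow {M : Matrix (Fin n) (Fin n) ℝ} (hM : IsSchur M) :
    Tendsto (fun j ↦ M ^ j) atTop (𝓝 0) := by
  have h := Matrix.tendsto_pow_zero_of_forall_spectrum_norm_lt_one hM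
  have hc : Continuous fun N : Matrix (Fin n) (Fin n) ℂ ↦ N.map Complex.re :=
    continuous_id.matrix_map Complex.continuous_re
  have := (hc.tendsto 0).comp h
  convert this using 2 with j
  · have : (M.map (Complex.ofReal ·)) ^ j = (M ^ j).map (Complex.ofReal ·) :=
      (map_pow Complex.ofRealHom.mapMatrix M j).symm
    ext
    simp [this]
  · ext; simp

theorem eq_zero_of_transpose_mul_mul_eq_self {N Z : Matrix (Fin n) (Fin n) ℝ}
    (hN : Tendsto (fun j ↦ N ^ j) atTop (𝓝 0)) (hZ : Nᵀ * Z * N = Z) : Z = 0 := by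
  have h : ∀ j : ℕ, (N ^ j)ᵀ * Z * N ^ j = Z := by
    intro j
    induction j with
    | zero => simp
    | succ j ih =>
      calc (N ^ (j + 1))ᵀ * Z * N ^ (j + 1) = (N ^ j)ᵀ * (Nᵀ * Z * N) * N ^ j := by
            rw [pow_succ']; simp only [transpose_mul, Matrix.mul_assoc]
        _ = Z := by rw [hZ, ih]
  have hlim : Tendsto (fun j : ℕ ↦ (N ^ j)ᵀ * Z * N ^ j) atTop (𝓝 0) := by
    have hc : Continuous fun M : Matrix (Fin n) (Fin n) ℝ ↦ Mᵀ * Z * M := by fun_prop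
    simpa [Function.comp_def] using (hc.tendsto 0).comp hN
  simp only [h] at hlim
  exact tendsto_nhds_unique tendsto_const_nhds hlim

theorem eq_of_lyapunov {N Z Z' W : Matrix (Fin n) (Fin n) ℝ}
    (hN : Tendsto (fun j ↦ N ^ j) atTop (𝓝 0)) (hZ : Nᵀ * Z * N + W = Z)
    (hZ' : Nᵀ * Z' * N + W = Z') : Z = Z' := by
  refine sub_eq_zero.1 (eq_zero_of_transpose_mul_mul_eq_self hN ?_)
  rw [Matrix.mul_sub, Matrix.sub_mul, eq_sub_of_add_eq hZ, eq_sub_of_add_eq hZ']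
  abel

theorem transpose_eq_of_lyapunov {N Z W : Matrix (Fin n) (Fin n) ℝ}
    (hN : Tendsto (fun j ↦ N ^ j) atTop (𝓝 0)) (hW : Wᵀ = W) (hZ : Nᵀ * Z * N + W = Z) :
    Zᵀ = Z := by
  refine eq_of_lyapunov hN ?_ hZ
  have := congrArg transpose hZ
  simpa [hW, Matrix.mul_assoc] using this

theorem posSemidef_of_lyapunov {N Z W : Matrix (Fin n) (Fin n) ℝ}
    (hN : Tendsto (fun j ↦ N ^ j) atTop (𝓝 0)) (hW : W.PosSemidef) (hZ : Nᵀ * Z * N + W = Z) :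
    Z.PosSemidef := by
  have hZs : Zᵀ = Z := transpose_eq_of_lyapunov hN (by simpa using hW.1.eq) hZ
  have hpos : ∀ j : ℕ, (Z - (N ^ j)ᵀ * Z * N ^ j).PosSemidef := by
    intro j
    induction j with
    | zero => simpa using PosSemidef.zero
    | succ j ih =>
      have : Z - (N ^ (j + 1))ᵀ * Z * N ^ (j + 1) =
          (Z - (N ^ j)ᵀ * Z * N ^ j) + (N ^ j)ᵀ * W * N ^ j := by
        have hW' : W = Z - Nᵀ * Z * N := by nth_rw 1 [← hZ]; abel
        rw [hW', pow_succ']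
        simp only [transpose_mul, Matrix.mul_assoc, Matrix.mul_sub, Matrix.sub_mul]
        abel
      rw [this]
      exact ih.add (by simpa using hW.conjTranspose_mul_mul_same (N ^ j))
  refine .of_dotProduct_mulVec_nonneg (by simpa [IsHermitian] using hZs) fun x ↦ ?_
  have hc : Continuous fun M : Matrix (Fin n) (Fin n) ℝ ↦ star x ⬝ᵥ ((Z - Mᵀ * Z * M) *ᵥ x) := by
    fun_prop
  have hlim := (hc.tendsto 0).comp hN
  simp only [Matrix.mul_zero, sub_zero] at hlim
  exact ge_of_tendsto' hlim fun j ↦ (hpos j).dotProduct_mulVec_nonneg x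

theorem isSchur_of_lyapunov {N Z W : Matrix (Fin n) (Fin n) ℝ} (hZp : Z.PosSemidef)
    (hW : W.PosDef) (hZ : Nᵀ * Z * N + W = Z) : IsSchur N := by
  intro μ hμ
  rw [← Matrix.spectrum_toLin', ← Module.End.hasEigenvalue_iff_mem_spectrum] at hμ
  obtain ⟨v, hv, hv0⟩ := hμ.exists_hasEigenvector
  rw [Module.End.mem_eigenspace_iff, Matrix.toLin'_apply] at hv
  set x : Fin n → ℝ := fun i ↦ (v i).re
  set y : Fin n → ℝ := fun i ↦ (v i).im
  have hx : N *ᵥ x = μ.re • x - μ.im • y := by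
    ext i
    simpa [mulVec, dotProduct, x, y] using congrArg Complex.re (congrFun hv i)
  have hy : N *ᵥ y = μ.im • x + μ.re • y := by
    ext i
    have := congrArg Complex.im (congrFun hv i)
    simp [mulVec, dotProduct] at this
    simp [mulVec, dotProduct, x, y, this]
    ring
  have hquad : ∀ u : Fin n → ℝ, (N *ᵥ u) ⬝ᵥ (Z *ᵥ (N *ᵥ u)) + u ⬝ᵥ (W *ᵥ u) = u ⬝ᵥ (Z *ᵥ u) := by
    intro u
    conv_rhs => rw [← hZ]
    rw [add_mulVec, dotProduct_add, ← mulVec_mulVec, ← mulVec_mulVec, dotProduct_mulVec u Nᵀ,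
      vecMul_transpose]
  have hWnn : ∀ u : Fin n → ℝ, 0 ≤ u ⬝ᵥ (W *ᵥ u) := fun u ↦ by
    simpa using hW.posSemidef.dotProduct_mulVec_nonneg u
  have hZnn : ∀ u : Fin n → ℝ, 0 ≤ u ⬝ᵥ (Z *ᵥ u) := fun u ↦ by
    simpa using hZp.dotProduct_mulVec_nonneg u
  have hWpos : 0 < x ⬝ᵥ (W *ᵥ x) + y ⬝ᵥ (W *ᵥ y) := by
    by_cases hx0 : x = 0
    · have hy0 : y ≠ 0 := by
        rintro hy0
        exact hv0 (funext fun i ↦ Complex.ext (congrFun hx0 i) (congrFun hy0 i))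
      have : 0 < y ⬝ᵥ (W *ᵥ y) := by simpa using hW.dotProduct_mulVec_pos hy0
      linarith [hWnn x]
    · have : 0 < x ⬝ᵥ (W *ᵥ x) := by simpa using hW.dotProduct_mulVec_pos hx0
      linarith [hWnn y]
  have ex := hquad x
  have ey := hquad y
  rw [hx] at ex
  rw [hy] at ey
  simp only [mulVec_sub, mulVec_add, mulVec_smul, dotProduct_sub, dotProduct_add, sub_dotProduct,
    add_dotProduct, smul_dotProduct, dotProduct_smul, smul_eq_mul] at ex ey
  have hμ2 : ‖μ‖ ^ 2 = μ.re ^ 2 + μ.im ^ 2 := by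
    rw [Complex.sq_norm, Complex.normSq_apply]; ring
  have hlt : ‖μ‖ ^ 2 < 1 := by
    rw [hμ2]
    nlinarith [hZnn x, hZnn y]
  nlinarith [norm_nonneg μ]

end Schur

section MatrixCalculus

open scoped ContDiff

variable {l m n : ℕ} {E : Type*} [NormedAddCommGroup E] [NormedSpace ℝ E]

theorem ContDiffOn.matrix_mul {s : Set E} {f : E → Matrix (Fin l) (Fin m) ℝ}
    {g : E → Matrix (Fin m) (Fin n) ℝ} {k : WithTop ℕ∞} (hf : ContDiffOn ℝ k f s)
    (hg : ContDiffOn ℝ k g s) : ContDiffOn ℝ k (fun x ↦ f x * g x) s := by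
  refine contDiffOn_pi.2 fun i ↦ contDiffOn_pi.2 fun j ↦ ?_
  simp only [Matrix.mul_apply]
  exact ContDiffOn.sum fun p _ ↦
    (contDiffOn_pi.1 (contDiffOn_pi.1 hf i) p).mul (contDiffOn_pi.1 (contDiffOn_pi.1 hg p) j)

theorem ContDiffOn.matrix_transpose {s : Set E} {f : E → Matrix (Fin l) (Fin m) ℝ}
    {k : WithTop ℕ∞} (hf : ContDiffOn ℝ k f s) : ContDiffOn ℝ k (fun x ↦ (f x)ᵀ) s :=
  contDiffOn_pi.2 fun i ↦ contDiffOn_pi.2 fun j ↦ contDiffOn_pi.1 (contDiffOn_pi.1 hf j) i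

theorem HasDerivAt.matrix_mul {f : ℝ → Matrix (Fin l) (Fin m) ℝ} {g : ℝ → Matrix (Fin m) (Fin n) ℝ}
    {f' : Matrix (Fin l) (Fin m) ℝ} {g' : Matrix (Fin m) (Fin n) ℝ} {t : ℝ}
    (hf : HasDerivAt f f' t) (hg : HasDerivAt g g' t) :
    HasDerivAt (fun s ↦ f s * g s) (f' * g t + f t * g') t := by
  refine hasDerivAt_pi.2 fun i ↦ hasDerivAt_pi.2 fun j ↦ ?_
  simp only [Matrix.add_apply, Matrix.mul_apply, ← Finset.sum_add_distrib]
  exact HasDerivAt.fun_sum fun p _ ↦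
    (hasDerivAt_pi.1 (hasDerivAt_pi.1 hf i) p).mul (hasDerivAt_pi.1 (hasDerivAt_pi.1 hg p) j)

theorem HasDerivAt.matrix_transpose {f : ℝ → Matrix (Fin l) (Fin m) ℝ}
    {f' : Matrix (Fin l) (Fin m) ℝ} {t : ℝ} (hf : HasDerivAt f f' t) :
    HasDerivAt (fun s ↦ (f s)ᵀ) f'ᵀ t :=
  hasDerivAt_pi.2 fun i ↦ hasDerivAt_pi.2 fun j ↦ hasDerivAt_pi.1 (hasDerivAt_pi.1 hf j) i

theorem contDiffOn_of_injective_linear {V : Type*} [NormedAddCommGroup V] [NormedSpace ℝ V]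
    [FiniteDimensional ℝ V] {S : Set E} {L : E → V →ₗ[ℝ] V} {W Z : E → V} {k : WithTop ℕ∞}
    (hL : ∀ v, ContDiffOn ℝ k (fun x ↦ L x v) S) (hinj : ∀ x ∈ S, Function.Injective (L x))
    (hW : ContDiffOn ℝ k W S) (hZ : ∀ x ∈ S, L x (Z x) = W x) : ContDiffOn ℝ k Z S := by
  have := FiniteDimensional.complete ℝ V
  have hinv : ∀ x ∈ S, (LinearMap.toContinuousLinearMap (L x)).IsInvertible := fun x hx ↦
    ⟨(LinearEquiv.ofInjectiveEndo _ (hinj x hx)).toContinuousLinearEquiv, by ext Z; rfl⟩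
  have hL' : ContDiffOn ℝ k (fun x ↦ LinearMap.toContinuousLinearMap (L x)) S :=
    contDiffOn_clm_apply.2 hL
  have hsol : ContDiffOn ℝ k
      (fun x ↦ (LinearMap.toContinuousLinearMap (L x)).inverse (W x)) S :=
    ContDiffOn.clm_apply
      (fun x hx ↦ ContDiffAt.comp_contDiffWithinAt (g := ContinuousLinearMap.inverse) x
        (hinv x hx).contDiffAt_map_inverse (hL' x hx)) hW
  refine hsol.congr fun x hx ↦ ?_
  rw [eq_comm, (hinv x hx).inverse_apply_eq]
  exact (hZ x hx).symm

/-- The operator `Z ↦ Z - Nᵀ Z N`. -/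
def lyapunovOp (N : Matrix (Fin n) (Fin n) ℝ) :
    Matrix (Fin n) (Fin n) ℝ →ₗ[ℝ] Matrix (Fin n) (Fin n) ℝ where
  toFun Z := Z - Nᵀ * Z * N
  map_add' Z Z' := by rw [Matrix.mul_add, Matrix.add_mul]; abel
  map_smul' c Z := by simp [smul_sub]

theorem lyapunovOp_apply (N Z : Matrix (Fin n) (Fin n) ℝ) :
    lyapunovOp N Z = Z - Nᵀ * Z * N := rfl

open Filter Topology in
theorem contDiffOn_of_lyapunov {S : Set E} {N W Z : E → Matrix (Fin n) (Fin n) ℝ}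
    {k : WithTop ℕ∞} (hN : ContDiffOn ℝ k N S) (hW : ContDiffOn ℝ k W S)
    (hpow : ∀ x ∈ S, Tendsto (fun j ↦ N x ^ j) atTop (𝓝 0))
    (hZ : ∀ x ∈ S, (N x)ᵀ * Z x * N x + W x = Z x) : ContDiffOn ℝ k Z S := by
  refine contDiffOn_of_injective_linear (L := fun x ↦ lyapunovOp (N x)) (fun M ↦ ?_)
    (fun x hx ↦ (injective_iff_map_eq_zero _).2 fun M hM ↦ ?_) hW fun x hx ↦ ?_
  · simp only [lyapunovOp_apply]
    exact contDiffOn_const.sub ((hN.matrix_transpose.matrix_mul contDiffOn_const).matrix_mul hN)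
  · exact eq_zero_of_transpose_mul_mul_eq_self (hpow x hx) (sub_eq_zero.1 hM).symm
  · exact (eq_sub_of_add_eq' (hZ x hx)).symm

end MatrixCalculus

section Compactness

variable {n m : ℕ}

theorem Matrix.PosDef.exists_pos_mul_sq_norm_le {R : Matrix (Fin n) (Fin n) ℝ} (hR : R.PosDef) :
    ∃ r > 0, ∀ x : Fin n → ℝ, r * ‖x‖ ^ 2 ≤ x ⬝ᵥ (R *ᵥ x) := by
  have hpos : ∀ x : Fin n → ℝ, x ≠ 0 → 0 < x ⬝ᵥ (R *ᵥ x) := fun x hx ↦ by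
    simpa using hR.dotProduct_mulVec_pos hx
  have hc : Continuous fun x : Fin n → ℝ ↦ x ⬝ᵥ (R *ᵥ x) := by fun_prop
  rcases (Metric.sphere (0 : Fin n → ℝ) 1).eq_empty_or_nonempty with he | hne
  · refine ⟨1, one_pos, fun x ↦ ?_⟩
    by_cases hx : x = 0
    · simp [hx]
    · have : ‖x‖⁻¹ • x ∈ Metric.sphere (0 : Fin n → ℝ) 1 := by simp [norm_smul, hx]
      simp [he] at this
  obtain ⟨u, hu, hmin⟩ := (isCompact_sphere (0 : Fin n → ℝ) 1).exists_isMinOn hne hc.continuousOn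
  refine ⟨u ⬝ᵥ (R *ᵥ u), hpos u (by rintro rfl; simp at hu), fun x ↦ ?_⟩
  by_cases hx : x = 0
  · simp [hx]
  have hmem : ‖x‖⁻¹ • x ∈ Metric.sphere (0 : Fin n → ℝ) 1 := by simp [norm_smul, hx]
  have h := hmin hmem
  simp only [Set.mem_ofPred_eq, mulVec_smul, dotProduct_smul, smul_dotProduct, smul_eq_mul] at h
  have hx' : 0 < ‖x‖ := norm_pos_iff.2 hx
  calc u ⬝ᵥ (R *ᵥ u) * ‖x‖ ^ 2 ≤ ‖x‖⁻¹ * (‖x‖⁻¹ * (x ⬝ᵥ (R *ᵥ x))) * ‖x‖ ^ 2 := by gcongr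
    _ = x ⬝ᵥ (R *ᵥ x) := by field_simp

theorem Matrix.mul_mul_transpose_apply_self (P : Matrix (Fin m) (Fin n) ℝ)
    (R : Matrix (Fin n) (Fin n) ℝ) (i : Fin m) : (P * R * Pᵀ) i i = P i ⬝ᵥ (R *ᵥ P i) := by
  rw [Matrix.mul_assoc, Matrix.mul_apply_eq_vecMul, ← Matrix.vecMul_vecMul, dotProduct_mulVec]
  rfl

/-- Pairs of a gain and a square root of its value matrix, with cost at most `c`. -/
def sublevelLift (A : Matrix (Fin n) (Fin n) ℝ) (B : Matrix (Fin n) (Fin m) ℝ)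
    (Q Sig : Matrix (Fin n) (Fin n) ℝ) (R : Matrix (Fin m) (Fin m) ℝ) (c : ℝ) :
    Set (Matrix (Fin m) (Fin n) ℝ × Matrix (Fin n) (Fin n) ℝ) :=
  {p | (A - B * p.1)ᵀ * (p.2ᵀ * p.2) * (A - B * p.1) + (p.1ᵀ * R * p.1 + Q) = p.2ᵀ * p.2} ∩
    {p | (p.2ᵀ * p.2 * Sig).trace ≤ c}

theorem isCompact_sublevelLift (A : Matrix (Fin n) (Fin n) ℝ) (B : Matrix (Fin n) (Fin m) ℝ)
    {Q Sig : Matrix (Fin n) (Fin n) ℝ} {R : Matrix (Fin m) (Fin m) ℝ}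
    (hQ : Q.PosDef) (hR : R.PosDef) (hSig : Sig.PosDef) (c : ℝ) :
    IsCompact (sublevelLift A B Q Sig R c) := by
  obtain ⟨r, hr, hrle⟩ := hR.exists_pos_mul_sq_norm_le
  obtain ⟨σ, hσ, hσle⟩ := hSig.exists_pos_mul_sq_norm_le
  have hclosed : IsClosed (sublevelLift A B Q Sig R c) := by
    refine IsClosed.inter (isClosed_eq ?_ ?_) (isClosed_le ?_ ?_) <;> fun_prop
  refine Metric.isCompact_of_isClosed_isBounded hclosed ?_
  rw [isBounded_iff_forall_norm_le]
  refine ⟨max √(n * (c / σ) / r) √(c / σ), ?_⟩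
  rintro ⟨K, P⟩ ⟨heq, htr⟩
  simp only [Set.mem_ofPred_eq] at heq htr
  have hSnn : ∀ i, 0 ≤ P i ⬝ᵥ (Sig *ᵥ P i) := fun i ↦
    (mul_nonneg hσ.le (sq_nonneg _)).trans (hσle _)
  have hrow : ∀ i, ‖P i‖ ^ 2 ≤ c / σ := by
    intro i
    rw [le_div_iff₀' hσ]
    refine (hσle _).trans (le_trans ?_ htr)
    rw [Matrix.mul_assoc, Matrix.trace_mul_comm, Matrix.trace]
    simp only [Matrix.diag_apply, Matrix.mul_mul_transpose_apply_self]
    exact Finset.single_le_sum (f := fun i ↦ P i ⬝ᵥ (Sig *ᵥ P i)) (fun j _ ↦ hSnn j)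
      (Finset.mem_univ i)
  have hent : ∀ i j, P i j ^ 2 ≤ c / σ := fun i j ↦ by
    refine le_trans ?_ (hrow i)
    rw [← sq_abs]
    gcongr
    exact norm_le_pi_norm (P i) j
  have hcol : ∀ j, ‖Kᵀ j‖ ^ 2 ≤ n * (c / σ) / r := by
    intro j
    rw [le_div_iff₀' hr]
    refine (hrle _).trans ?_
    have h := congrFun (congrFun heq j) j
    have h1 : 0 ≤ ((A - B * K)ᵀ * (Pᵀ * P) * (A - B * K)) j j := by
      have := (posSemidef_conjTranspose_mul_self (P * (A - B * K))).diag_nonneg (i := j)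
      simpa [Matrix.mul_assoc] using this
    have h2 : 0 ≤ Q j j := hQ.posSemidef.diag_nonneg
    have h3 : (Kᵀ * R * K) j j = Kᵀ j ⬝ᵥ (R *ᵥ Kᵀ j) :=
      Matrix.mul_mul_transpose_apply_self Kᵀ R j
    have h4 : (Pᵀ * P) j j ≤ n * (c / σ) := by
      rw [Matrix.mul_apply]
      calc ∑ i, Pᵀ j i * P i j ≤ ∑ _i : Fin n, c / σ := Finset.sum_le_sum fun i _ ↦ by
            simpa [pow_two] using hent i j
        _ = n * (c / σ) := by simp
    simp only [Matrix.add_apply] at h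
    linarith
  refine norm_prod_le_iff.2 ⟨(Matrix.norm_le_iff (by positivity)).2 fun i j ↦ ?_,
    (Matrix.norm_le_iff (by positivity)).2 fun i j ↦ ?_⟩
  · refine le_max_of_le_left (Real.le_sqrt_of_sq_le (le_trans ?_ (hcol j)))
    gcongr
    exact norm_le_pi_norm (Kᵀ j) i
  · refine le_max_of_le_right (Real.le_sqrt_of_sq_le ?_)
    rw [Real.norm_eq_abs, sq_abs]
    exact hent i j

end Compactness

section LQR

open scoped ContDiff

variable {n m : ℕ} {A : Matrix (Fin n) (Fin n) ℝ} {B : Matrix (Fin n) (Fin m) ℝ}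
  {Q Sig : Matrix (Fin n) (Fin n) ℝ} {R : Matrix (Fin m) (Fin m) ℝ}
  {X Y : Matrix (Fin m) (Fin n) ℝ → Matrix (Fin n) (Fin n) ℝ}

theorem isOpen_setOf_isSchur_sub_mul (A : Matrix (Fin n) (Fin n) ℝ)
    (B : Matrix (Fin n) (Fin m) ℝ) : IsOpen {K : Matrix (Fin m) (Fin n) ℝ | IsSchur (A - B * K)} :=
  isOpen_setOf_isSchur.preimage
    (f := fun K : Matrix (Fin m) (Fin n) ℝ ↦ A - B * K) (by fun_prop)

open scoped MatrixOrder in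
theorem isCompact_lqr_sublevel (hQ : Q.PosDef) (hR : R.PosDef) (hSig : Sig.PosDef)
    (hX : ∀ K, IsSchur (A - B * K) →
      (A - B * K)ᵀ * X K * (A - B * K) + Kᵀ * R * K + Q = X K) (c : ℝ) :
    IsCompact {K ∈ {K : Matrix (Fin m) (Fin n) ℝ | IsSchur (A - B * K)} |
      (X K * Sig).trace ≤ c} := by
  have hKRK : ∀ K : Matrix (Fin m) (Fin n) ℝ, (Kᵀ * R * K + Q).PosDef := fun K ↦ by
    have := hR.posSemidef.conjTranspose_mul_mul_same K
    rw [conjTranspose_eq_transpose_of_trivial] at this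
    exact PosDef.posSemidef_add this hQ
  convert (isCompact_sublevelLift A B hQ hR hSig c).image continuous_fst
  ext K
  constructor
  · rintro ⟨hK, hc⟩
    have hXK := hX K hK
    rw [add_assoc] at hXK
    have hpsd := posSemidef_of_lyapunov hK.tendsto_pow (hKRK K).posSemidef hXK
    obtain ⟨P, hP⟩ : ∃ P : Matrix (Fin n) (Fin n) ℝ, X K = Pᵀ * P := by
      have := hpsd.nonneg
      rw [CStarAlgebra.nonneg_iff_eq_star_mul_self] at this
      simpa [star_eq_conjTranspose] using this
    refine ⟨(K, P), ⟨?_, ?_⟩, rfl⟩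
    · simpa only [Set.mem_ofPred_eq, ← hP] using hXK
    · simpa only [Set.mem_ofPred_eq, ← hP] using hc
  · rintro ⟨⟨K, P⟩, ⟨heq, hc⟩, rfl⟩
    have hpsd : (Pᵀ * P).PosSemidef := by simpa using posSemidef_conjTranspose_mul_self P
    have hK : IsSchur (A - B * K) := isSchur_of_lyapunov hpsd (hKRK K) heq
    have hXK := hX K hK
    rw [add_assoc] at hXK
    refine ⟨hK, ?_⟩
    rw [eq_of_lyapunov hK.tendsto_pow hXK heq]
    exact hc

theorem IsSchur.tendsto_transpose_pow {M : Matrix (Fin n) (Fin n) ℝ} (hM : IsSchur M) :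
    Filter.Tendsto (fun j ↦ Mᵀ ^ j) Filter.atTop (nhds 0) := by
  have hc : Continuous fun N : Matrix (Fin n) (Fin n) ℝ ↦ Nᵀ := by fun_prop
  simpa [Function.comp_def, transpose_pow] using (hc.tendsto 0).comp hM.tendsto_pow

theorem contDiffOn_closedLoop :
    ContDiffOn ℝ ∞ (fun K : Matrix (Fin m) (Fin n) ℝ ↦ A - B * K)
      {K : Matrix (Fin m) (Fin n) ℝ | IsSchur (A - B * K)} :=
  contDiffOn_const.sub (contDiffOn_const.matrix_mul contDiffOn_id)

theorem contDiffOn_valueMatrix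
    (hX : ∀ K, IsSchur (A - B * K) →
      (A - B * K)ᵀ * X K * (A - B * K) + Kᵀ * R * K + Q = X K) :
    ContDiffOn ℝ ∞ X {K : Matrix (Fin m) (Fin n) ℝ | IsSchur (A - B * K)} :=
  contDiffOn_of_lyapunov (W := fun K ↦ Kᵀ * R * K + Q) contDiffOn_closedLoop
    (((contDiffOn_id.matrix_transpose.matrix_mul contDiffOn_const).matrix_mul
      contDiffOn_id).add contDiffOn_const)
    (fun _ hK ↦ IsSchur.tendsto_pow hK) fun K hK ↦ by rw [← add_assoc]; exact hX K hK

theorem contDiffOn_covarianceMatrix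
    (hY : ∀ K, IsSchur (A - B * K) →
      (A - B * K) * Y K * (A - B * K)ᵀ + Sig = Y K) :
    ContDiffOn ℝ ∞ Y {K : Matrix (Fin m) (Fin n) ℝ | IsSchur (A - B * K)} :=
  contDiffOn_of_lyapunov (W := fun _ ↦ Sig) (N := fun K ↦ (A - B * K)ᵀ)
    contDiffOn_closedLoop.matrix_transpose contDiffOn_const
    (fun _ hK ↦ IsSchur.tendsto_transpose_pow hK)
    fun K hK ↦ by rw [transpose_transpose]; exact hY K hK

theorem contDiffOn_gradField
    (hX : ∀ K, IsSchur (A - B * K) →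
      (A - B * K)ᵀ * X K * (A - B * K) + Kᵀ * R * K + Q = X K)
    (hY : ∀ K, IsSchur (A - B * K) →
      (A - B * K) * Y K * (A - B * K)ᵀ + Sig = Y K) :
    ContDiffOn ℝ ∞ (fun K ↦ -((2 : ℝ) • ((R * K - Bᵀ * X K * (A - B * K)) * Y K)))
      {K : Matrix (Fin m) (Fin n) ℝ | IsSchur (A - B * K)} :=
  (((contDiffOn_const.matrix_mul contDiffOn_id).sub
    ((contDiffOn_const.matrix_mul (contDiffOn_valueMatrix hX)).matrix_mul
      contDiffOn_closedLoop)).matrix_mul (contDiffOn_covarianceMatrix hY)).const_smul 2 |>.neg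

theorem trace_mul_eq_of_lyapunov {M Y' X' W : Matrix (Fin n) (Fin n) ℝ}
    (hY : M * Y' * Mᵀ + Sig = Y') (hX' : Mᵀ * X' * M + W = X') :
    (X' * Sig).trace = (W * Y').trace := by
  rw [eq_sub_of_add_eq' hY, eq_sub_of_add_eq' hX', Matrix.mul_sub, Matrix.sub_mul, trace_sub,
    trace_sub]
  congr 1
  rw [← Matrix.mul_assoc, trace_mul_comm, ← Matrix.mul_assoc, ← Matrix.mul_assoc]

/-- The continuous linear functional `Z ↦ Tr (Z N)`. -/
noncomputable def traceMulCLM (N : Matrix (Fin n) (Fin n) ℝ) : Matrix (Fin n) (Fin n) ℝ →L[ℝ] ℝ :=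
  LinearMap.toContinuousLinearMap (Matrix.traceLinearMap (Fin n) ℝ ℝ ∘ₗ LinearMap.mulRight ℝ N)

theorem fderiv_lqrCost_gradField_nonpos (hQ : Q.PosDef) (hR : R.PosDef) (hSig : Sig.PosDef)
    (hX : ∀ K, IsSchur (A - B * K) →
      (A - B * K)ᵀ * X K * (A - B * K) + Kᵀ * R * K + Q = X K)
    (hY : ∀ K, IsSchur (A - B * K) →
      (A - B * K) * Y K * (A - B * K)ᵀ + Sig = Y K)
    {K : Matrix (Fin m) (Fin n) ℝ} (hK : IsSchur (A - B * K)) :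
    fderiv ℝ (fun K ↦ (X K * Sig).trace) K
      (-((2 : ℝ) • ((R * K - Bᵀ * X K * (A - B * K)) * Y K))) ≤ 0 := by
  have hRt : Rᵀ = R := by simpa using hR.1.eq
  have hQt : Qᵀ = Q := by simpa using hQ.1.eq
  have hSt : Sigᵀ = Sig := by simpa using hSig.1.eq
  have hXt : (X K)ᵀ = X K := transpose_eq_of_lyapunov hK.tendsto_pow
    (W := Kᵀ * R * K + Q) (by simp [hRt, hQt, Matrix.mul_assoc])
    (by rw [← add_assoc]; exact hX K hK)
  have hYt : (Y K)ᵀ = Y K := transpose_eq_of_lyapunov hK.tendsto_transpose_pow hSt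
    (by rw [transpose_transpose]; exact hY K hK)
  set G := R * K - Bᵀ * X K * (A - B * K) with hG
  set D := -((2 : ℝ) • (G * Y K)) with hD
  have hS := isOpen_setOf_isSchur_sub_mul A B
  have hXd : DifferentiableAt ℝ X K :=
    ((contDiffOn_valueMatrix hX).contDiffAt (hS.mem_nhds hK)).differentiableAt (by simp)
  have hc : HasDerivAt (fun t : ℝ ↦ K + t • D) D 0 := by
    exact (((hasDerivAt_id (0 : ℝ)).smul_const D).const_add K).congr_deriv (one_smul ℝ D)
  have hXc : HasDerivAt (fun t : ℝ ↦ X (K + t • D)) (fderiv ℝ X K D) 0 := by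
    have h : HasFDerivAt X (fderiv ℝ X K) (K + (0 : ℝ) • D) := by simpa using hXd.hasFDerivAt
    exact h.comp_hasDerivAt 0 hc
  set X' := fderiv ℝ X K D
  have hVc : fderiv ℝ (fun K ↦ (X K * Sig).trace) K D = (X' * Sig).trace := by
    have h : HasFDerivAt (fun K ↦ (X K * Sig).trace) (traceMulCLM Sig ∘L fderiv ℝ X K) K :=
      (traceMulCLM Sig).hasFDerivAt.comp K hXd.hasFDerivAt
    rw [h.fderiv]
    rfl
  have hN : HasDerivAt (fun t : ℝ ↦ A - B * (K + t • D)) (-(B * D)) 0 := by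
    exact (((hasDerivAt_const (0 : ℝ) B).matrix_mul hc).const_sub A).congr_deriv (by simp)
  have hlhs := (((hN.matrix_transpose.matrix_mul hXc).matrix_mul hN).add
    ((hc.matrix_transpose.matrix_mul (hasDerivAt_const (0 : ℝ) R)).matrix_mul hc)).add_const Q
  have hev : (fun t : ℝ ↦ X (K + t • D)) =ᶠ[nhds 0] fun t ↦
      (A - B * (K + t • D))ᵀ * X (K + t • D) * (A - B * (K + t • D)) +
        (K + t • D)ᵀ * R * (K + t • D) + Q := by
    have : ∀ᶠ t : ℝ in nhds 0, IsSchur (A - B * (K + t • D)) := by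
      refine hc.continuousAt.eventually (p := fun K ↦ IsSchur (A - B * K)) ?_
      simp only [zero_smul, add_zero]
      exact hS.mem_nhds hK
    filter_upwards [this] with t ht using (hX _ ht).symm
  have hX' := (hlhs.congr_of_eventuallyEq hev).unique hXc
  simp only [zero_smul, add_zero, Matrix.mul_zero] at hX'
  have hL : (A - B * K)ᵀ * X' * (A - B * K) + (Dᵀ * G + Gᵀ * D) = X' := by
    refine Eq.trans ?_ hX'
    simp only [hG, transpose_sub, transpose_neg, transpose_mul, hXt, hRt, transpose_transpose,
      Matrix.mul_sub, Matrix.sub_mul, Matrix.add_mul, Matrix.mul_neg,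
      Matrix.neg_mul, Matrix.mul_assoc]
    abel
  rw [hVc, trace_mul_eq_of_lyapunov (hY K hK) hL]
  have hpos : 0 ≤ ((G * Y K)ᵀ * (G * Y K)).trace := by
    simpa using (posSemidef_conjTranspose_mul_self (G * Y K)).trace_nonneg
  have h1 : (Dᵀ * G * Y K).trace = -2 * ((G * Y K)ᵀ * (G * Y K)).trace := by
    simp [hD, Matrix.mul_assoc]
  have h2 : (Gᵀ * D * Y K).trace = -2 * ((G * Y K)ᵀ * (G * Y K)).trace := by
    rw [trace_mul_comm, ← Matrix.mul_assoc, hD, transpose_mul, hYt]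
    simp
  rw [Matrix.add_mul, trace_add, h1, h2]
  linarith

theorem differentiableOn_lqrCost
    (hX : ∀ K, IsSchur (A - B * K) →
      (A - B * K)ᵀ * X K * (A - B * K) + Kᵀ * R * K + Q = X K) :
    DifferentiableOn ℝ (fun K ↦ (X K * Sig).trace)
      {K : Matrix (Fin m) (Fin n) ℝ | IsSchur (A - B * K)} :=
  (traceMulCLM Sig).differentiable.comp_differentiableOn
    ((contDiffOn_valueMatrix hX).differentiableOn (by simp))

end LQR

theorem stmt9 {n m : ℕ} (hn : 0 < n) (hm : 0 < m)
    (A : Matrix (Fin n) (Fin n) ℝ) (B : Matrix (Fin n) (Fin m) ℝ)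
    (Q Sig : Matrix (Fin n) (Fin n) ℝ) (R : Matrix (Fin m) (Fin m) ℝ)
    (hQ : Q.PosDef) (hR : R.PosDef) (hSig : Sig.PosDef)
    (X : Matrix (Fin m) (Fin n) ℝ → Matrix (Fin n) (Fin n) ℝ)
    (Y : Matrix (Fin m) (Fin n) ℝ → Matrix (Fin n) (Fin n) ℝ)
    (hX : ∀ K, IsSchur (A - B * K) →
      (A - B * K)ᵀ * X K * (A - B * K) + Kᵀ * R * K + Q = X K)
    (hY : ∀ K, IsSchur (A - B * K) →
      (A - B * K) * Y K * (A - B * K)ᵀ + Sig = Y K)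
    (K₀ : Matrix (Fin m) (Fin n) ℝ) (hK₀ : IsSchur (A - B * K₀)) :
    (∃ Kc : ℝ → Matrix (Fin m) (Fin n) ℝ, IsGradFlowSol A B R X Y K₀ Kc) ∧
    ∀ Kc₁ Kc₂ : ℝ → Matrix (Fin m) (Fin n) ℝ,
      IsGradFlowSol A B R X Y K₀ Kc₁ → IsGradFlowSol A B R X Y K₀ Kc₂ →
      Set.EqOn Kc₁ Kc₂ (Set.Ici (0 : ℝ)) := by
  have hS := isOpen_setOf_isSchur_sub_mul A B
  have hF := contDiffOn_gradField hX hY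
  refine ⟨?_, fun Kc₁ Kc₂ h₁ h₂ ↦ ?_⟩
  · obtain ⟨γ, h0, hγ, h⟩ := exists_contDiff_flow_of_isCompact_sublevel hS hF
      (differentiableOn_lqrCost (Sig := Sig) hX)
      (fun K hK ↦ fderiv_lqrCost_gradField_nonpos hQ hR hSig hX hY hK) hK₀
      (isCompact_lqr_sublevel hQ hR hSig hX _)
    exact ⟨γ, h0, fun t ht ↦ (h t ht).1, hγ.contDiffOn, fun t ht ↦ (h t ht).2.hasDerivWithinAt⟩
  · exact eqOn_Ici_of_hasDerivWithinAt hS hF h₁.2.1 h₂.2.1 h₁.2.2.2 h₂.2.2.2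
      (h₁.1.trans h₂.1.symm)
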